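/- Assume Hypothesis (H). Then there exists exactly one quasi-stationary distribution for X, i.e., exactly one probability measure ρ on ℕ* such that ℙ_ρ(X_t ∈ · | t < T_0) = ρ for all t ≥ 0. -/

import Mathlib

open MeasureTheory ENNReal Set Filter
open scoped NNReal ENNReal

noncomputable section

/-- A right-continuous, time-homogeneous Markov process on `ℕ` with laws `P x`
(`P x (X 0 = x) = 1`), in which the state `0` is absorbing and absorption is
almost sure. The (time-homogeneous, countable-state) Markov property is stated
in terms of the shifted path. -/
structure AbsorbedProcess (Ω : Type*) [MeasurableSpace Ω] where
  P : ℕ → Measure Ω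
  prob : ∀ x, IsProbabilityMeasure (P x)
  X : ℝ≥0 → Ω → ℕ
  meas : ∀ t, Measurable (X t)
  init : ∀ x, P x {ω | X 0 ω = x} = 1
  rightCont : ∀ x, ∀ᵐ ω ∂ P x, ∀ t : ℝ≥0, ∃ ε : ℝ≥0, 0 < ε ∧
    ∀ s : ℝ≥0, t ≤ s → s < t + ε → X s ω = X t ω
  markov : ∀ (x y : ℕ) (s : ℝ≥0) (B : Set (ℝ≥0 → ℕ)), MeasurableSet B →
    P x ({ω | X s ω = y} ∩ {ω | (fun u => X (s + u) ω) ∈ B})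
      = P x {ω | X s ω = y} * P y {ω | (fun u => X u ω) ∈ B}
  absorbing : ∀ x, ∀ᵐ ω ∂ P x, ∀ s t : ℝ≥0, s ≤ t → X s ω = 0 → X t ω = 0
  absorbSure : ∀ x, P x {ω | ∃ t : ℝ≥0, X t ω = 0} = 1

variable {Ω : Type*} [MeasurableSpace Ω]

/-- The hitting time `T_K = inf {t ≥ 0 : X_t ∈ K}` (equal to `∞` if `K` is never hit). -/
def hitT (M : AbsorbedProcess Ω) (K : Set ℕ) (ω : Ω) : ℝ≥0∞ :=
  ⨅ t : {t : ℝ≥0 // M.X t ω ∈ K}, (t.1 : ℝ≥0∞)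

/-- The survival event `{t < T_0}`. -/
def alive (M : AbsorbedProcess Ω) (t : ℝ≥0) : Set Ω := {ω | (t : ℝ≥0∞) < hitT M {0} ω}

/-- `ℙ_μ = ∑_x μ({x}) ℙ_x`. -/
def Pmu (M : AbsorbedProcess Ω) (μ : Measure ℕ) : Measure Ω := μ.bind M.P

/-- The conditional distribution `ℙ_μ(X_t ∈ · | t < T_0)`, as a measure on `ℕ`. -/
def condDist (M : AbsorbedProcess Ω) (μ : Measure ℕ) (t : ℝ≥0) : Measure ℕ :=
  (Pmu M μ (alive M t))⁻¹ • ((Pmu M μ).restrict (alive M t)).map (M.X t)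

/-- Total variation distance between two measures on `ℕ`:
`‖μ - ν‖_TV = ∑_x |μ({x}) - ν({x})|`. -/
def tvDist (μ ν : Measure ℕ) : ℝ := ∑' x : ℕ, |(μ {x}).toReal - (ν {x}).toReal|

/-- `e^{l·t}` for an extended nonnegative time `t`. -/
def expE (l : ℝ) (t : ℝ≥0∞) : ℝ≥0∞ :=
  if t = ∞ then ∞ else ENNReal.ofReal (Real.exp (l * t.toReal))

/-- Hypothesis (H): there are `K ⊆ ℕ*`, `x₀ ∈ K` and positive constants
`c₁, c₂, c₃, c₄, λ₀` such that
(1) `ℙ_x(X_1 = x₀ | 1 < T_0) ≥ c₁` for all `x ∈ ℕ*`;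
(2) `inf_{x ∈ K} ℙ_x(t < T_0) ≥ c₂ sup_{x ∈ K} ℙ_x(t < T_0)` for all `t ≥ 0`;
(3) `ℙ_{x₀}(X_t ∈ K) ≥ c₃ e^{-λ₀ t}` for all `t ≥ 0`;
(4) `sup_{x ∈ ℕ*} 𝔼_x(e^{λ₀ (T_K ∧ T_0)}) ≤ c₄`. -/
def HypH (M : AbsorbedProcess Ω) (K : Set ℕ) (x0 : ℕ) (c1 c2 c3 c4 l0 : ℝ) : Prop :=
  0 ∉ K ∧ x0 ∈ K ∧ 0 < c1 ∧ 0 < c2 ∧ 0 < c3 ∧ 0 < c4 ∧ 0 < l0 ∧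
  (∀ x : ℕ, x ≠ 0 → ENNReal.ofReal c1 * M.P x (alive M 1)
      ≤ M.P x ({ω | M.X 1 ω = x0} ∩ alive M 1)) ∧
  (∀ t : ℝ≥0, ∀ x ∈ K, ∀ y ∈ K,
      ENNReal.ofReal c2 * M.P y (alive M t) ≤ M.P x (alive M t)) ∧
  (∀ t : ℝ≥0, ENNReal.ofReal (c3 * Real.exp (-(l0 * (t : ℝ)))) ≤ M.P x0 {ω | M.X t ω ∈ K}) ∧
  (∀ x : ℕ, x ≠ 0 →
      ∫⁻ ω, expE l0 (min (hitT M K ω) (hitT M {0} ω)) ∂ M.P x ≤ ENNReal.ofReal c4)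

theorem eq_zero_of_add_le_succ {g : ℕ → ℝ≥0∞} {ε B : ℝ≥0∞} (hB : B ≠ ∞)
    (hg : ∀ n, g n + ε ≤ g (n + 1)) (hgB : ∀ n, g n ≤ B) : ε = 0 := by
  have h : ∀ n : ℕ, (n : ℝ≥0∞) * ε ≤ g n := by
    intro n
    induction n with
    | zero => simp
    | succ n ih =>
      push_cast
      rw [add_mul, one_mul]
      exact (add_le_add_left ih ε).trans (hg n)
  by_contra h0
  obtain ⟨n, hn⟩ := ENNReal.exists_nat_mul_gt h0 hB
  exact absurd ((h n).trans (hgB n)) (not_le.2 hn)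

theorem eq_zero_of_succ_add_le {g : ℕ → ℝ≥0∞} {ε : ℝ≥0∞} (h0 : g 0 ≠ ∞)
    (hg : ∀ n, g (n + 1) + ε ≤ g n) : ε = 0 := by
  have h : ∀ n : ℕ, g n + (n : ℝ≥0∞) * ε ≤ g 0 := by
    intro n
    induction n with
    | zero => simp
    | succ n ih =>
      push_cast
      rw [add_mul, one_mul, add_comm _ ε, ← add_assoc]
      exact (add_le_add_left (hg n) _).trans ih
  by_contra hε
  obtain ⟨n, hn⟩ := ENNReal.exists_nat_mul_gt hε h0
  exact absurd (le_add_self.trans (h n)) (not_le.2 hn)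

theorem le_of_forall_mul_pow_le {a b c C : ℝ} (hb : 0 < b) (hc : 0 < c)
    (h : ∀ n : ℕ, c * a ^ n ≤ C * b ^ n) : a ≤ b := by
  by_contra! hab
  obtain ⟨n, hn⟩ := pow_unbounded_of_one_lt (C / c) ((one_lt_div hb).2 hab)
  rw [div_pow, div_lt_div_iff₀ hc (pow_pos hb n)] at hn
  linarith [h n, mul_comm c (a ^ n)]

section Kernel

variable {ι : Type*} {p : ι → ι → ℝ≥0∞} {x0 : ι} {c C : ℝ≥0∞}

/-- Survival probabilities of the sub-Markovian kernel `p` after `n` steps. -/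
def survival (p : ι → ι → ℝ≥0∞) : ℕ → ι → ℝ≥0∞
  | 0, _ => 1
  | n + 1, x => ∑' y, p x y * survival p n y

theorem survival_one (x : ι) : survival p 1 x = ∑' y, p x y := by
  simp [survival]

theorem survival_le_one (hp : ∀ x, ∑' y, p x y ≤ 1) (n : ℕ) (x : ι) : survival p n x ≤ 1 := by
  induction n generalizing x with
  | zero => exact le_rfl
  | succ n ih =>
    calc survival p (n + 1) x ≤ ∑' y, p x y * 1 :=
          ENNReal.tsum_le_tsum fun y => mul_le_mul_right (ih y) _
      _ ≤ 1 := by simpa using hp x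

theorem tsum_mul_survival_succ (m : ι → ℝ≥0∞) (n : ℕ) :
    ∑' x, m x * survival p (n + 1) x = ∑' y, (∑' x, m x * p x y) * survival p n y := by
  simp_rw [survival, ← ENNReal.tsum_mul_left, ← ENNReal.tsum_mul_right]
  rw [ENNReal.tsum_comm]
  simp_rw [mul_assoc]

theorem survival_add_le (hC : ∀ n x, survival p n x ≤ C * survival p n x0) (n m : ℕ) (x : ι) :
    survival p (n + m) x ≤ C * survival p n x * survival p m x0 := by
  induction n generalizing x with
  | zero => simpa [survival] using hC m x
  | succ n ih =>
    rw [Nat.add_right_comm]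
    calc survival p (n + m + 1) x
        ≤ ∑' y, p x y * (C * survival p n y * survival p m x0) :=
          ENNReal.tsum_le_tsum fun y => mul_le_mul_right (ih y) _
      _ = C * survival p (n + 1) x * survival p m x0 := by
          simp_rw [survival, ← ENNReal.tsum_mul_left, ← ENNReal.tsum_mul_right]
          exact tsum_congr fun y => by ring

theorem le_survival_succ_add (hc : ∀ x, c * ∑' y, p x y ≤ p x x0) (n m : ℕ) (x : ι) :
    c * survival p (n + 1) x * survival p m x0 ≤ survival p (n + 1 + m) x := by
  induction n generalizing x with
  | zero =>
    rw [zero_add, survival_one, add_comm]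
    calc _ ≤ p x x0 * survival p m x0 := mul_le_mul_left (hc x) _
      _ ≤ survival p (m + 1) x := ENNReal.le_tsum (f := fun y => p x y * survival p m y) x0
  | succ n ih =>
    rw [Nat.add_right_comm (n + 1)]
    calc c * survival p (n + 1 + 1) x * survival p m x0
        = ∑' y, p x y * (c * survival p (n + 1) y * survival p m x0) := by
          rw [survival, ← ENNReal.tsum_mul_left, ← ENNReal.tsum_mul_right]
          exact tsum_congr fun y => by ring
      _ ≤ survival p (n + 1 + m + 1) x :=
          ENNReal.tsum_le_tsum fun y => mul_le_mul_right (ih y) _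

theorem survival_mul_le (hC : ∀ n x, survival p n x ≤ C * survival p n x0) (n k : ℕ) :
    survival p (n * (k + 1)) x0 ≤ C ^ k * survival p n x0 ^ (k + 1) := by
  induction k with
  | zero => simp
  | succ k ih =>
    rw [mul_add n (k + 1), mul_one, add_comm]
    calc _ ≤ C * survival p n x0 * survival p (n * (k + 1)) x0 := survival_add_le hC _ _ _
      _ ≤ C * survival p n x0 * (C ^ k * survival p n x0 ^ (k + 1)) := mul_le_mul_right ih _
      _ = _ := by ring

theorem le_survival_mul (hc : ∀ x, c * ∑' y, p x y ≤ p x x0) (n k : ℕ) :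
    c ^ k * survival p (n + 1) x0 ^ (k + 1) ≤ survival p ((n + 1) * (k + 1)) x0 := by
  induction k with
  | zero => simp
  | succ k ih =>
    rw [mul_add (n + 1) (k + 1), mul_one, add_comm ((n + 1) * (k + 1))]
    calc _ = c * survival p (n + 1) x0 * (c ^ k * survival p (n + 1) x0 ^ (k + 1)) := by ring
      _ ≤ c * survival p (n + 1) x0 * survival p ((n + 1) * (k + 1)) x0 := mul_le_mul_right ih _
      _ ≤ _ := le_survival_succ_add hc _ _ _

theorem doeblin_const_le_one (hp : ∀ x, ∑' y, p x y ≤ 1)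
    (hc : ∀ x, c * ∑' y, p x y ≤ p x x0) (hpos : ∀ n, survival p n x0 ≠ 0) : c ≤ 1 := by
  have h1 : ∑' y, p x0 y ≠ 0 := survival_one (p := p) x0 ▸ hpos 1
  have h2 : ∑' y, p x0 y ≠ ∞ := ne_top_of_le_ne_top one_ne_top (hp x0)
  have := (hc x0).trans (ENNReal.le_tsum x0)
  rwa [← ENNReal.le_div_iff_mul_le (Or.inl h1) (Or.inl h2), ENNReal.div_self h1 h2] at this

theorem one_le_survival_const (hC : ∀ n x, survival p n x ≤ C * survival p n x0) : 1 ≤ C := by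
  simpa [survival] using hC 0 x0

/-- The survival probabilities from `x0` are comparable with a geometric sequence. -/
theorem exists_geometric_survival (hp : ∀ x, ∑' y, p x y ≤ 1)
    (hc0 : c ≠ 0) (hc : ∀ x, c * ∑' y, p x y ≤ p x x0)
    (hCt : C ≠ ∞) (hC : ∀ n x, survival p n x ≤ C * survival p n x0)
    (hpos : ∀ n, survival p n x0 ≠ 0) :
    ∃ θ : ℝ≥0∞, θ ≠ 0 ∧ θ ≠ ∞ ∧
      ∀ n, c * survival p n x0 ≤ θ ^ n ∧ θ ^ n ≤ C * survival p n x0 := by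
  have hc1 := doeblin_const_le_one hp hc hpos
  have hC1 := one_le_survival_const hC
  have hct : c ≠ ∞ := ne_top_of_le_ne_top one_ne_top hc1
  have hst : ∀ n, survival p n x0 ≠ ∞ :=
    fun n => ne_top_of_le_ne_top one_ne_top (survival_le_one hp n x0)
  have hC0 : C ≠ 0 := (zero_lt_one.trans_le hC1).ne'
  set A : ℕ → ℝ := fun n => (c * survival p n x0).toReal
  set B : ℕ → ℝ := fun n => (C * survival p n x0).toReal
  have hA : ∀ n, 0 < A n := fun n =>
    ENNReal.toReal_pos (mul_ne_zero hc0 (hpos n)) (ENNReal.mul_ne_top hct (hst n))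
  have hB : ∀ n, 0 < B n := fun n =>
    ENNReal.toReal_pos (mul_ne_zero hC0 (hpos n)) (ENNReal.mul_ne_top hCt (hst n))
  have key : ∀ n k : ℕ, A (n + 1) ^ (k + 1) ≤ B (k + 1) ^ (n + 1) := by
    intro n k
    simp only [A, B, ← ENNReal.toReal_pow]
    refine ENNReal.toReal_mono (ENNReal.pow_ne_top (ENNReal.mul_ne_top hCt (hst _))) ?_
    calc (c * survival p (n + 1) x0) ^ (k + 1)
        = c * (c ^ k * survival p (n + 1) x0 ^ (k + 1)) := by ring
      _ ≤ 1 * survival p ((n + 1) * (k + 1)) x0 := mul_le_mul' hc1 (le_survival_mul hc n k)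
      _ ≤ C * survival p ((k + 1) * (n + 1)) x0 := by
          rw [mul_comm (n + 1)]; exact mul_le_mul_left hC1 _
      _ ≤ C * (C ^ n * survival p (k + 1) x0 ^ (n + 1)) :=
          mul_le_mul_right (survival_mul_le hC _ _) _
      _ = _ := by ring
  have hlog : ∀ n k : ℕ, Real.log (A (n + 1)) / (n + 1 : ℝ) ≤ Real.log (B (k + 1)) / (k + 1 : ℝ) := by
    intro n k
    rw [div_le_div_iff₀ (by positivity) (by positivity)]
    have := Real.log_le_log (pow_pos (hA _) _) (key n k)
    rw [Real.log_pow, Real.log_pow] at this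
    push_cast at this
    linarith
  set l : ℝ := ⨆ n : ℕ, Real.log (A (n + 1)) / (n + 1 : ℝ)
  have hl1 : ∀ n : ℕ, Real.log (A (n + 1)) / (n + 1 : ℝ) ≤ l := fun n =>
    le_ciSup (f := fun n : ℕ => Real.log (A (n + 1)) / (n + 1 : ℝ))
      ⟨_, by rintro _ ⟨n, rfl⟩; exact hlog n 0⟩ n
  have hl2 : ∀ n : ℕ, l ≤ Real.log (B (n + 1)) / (n + 1 : ℝ) := fun n => ciSup_le fun k => hlog k n
  refine ⟨ENNReal.ofReal (Real.exp l), by simp [Real.exp_pos], ofReal_ne_top, fun n => ?_⟩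
  cases n with
  | zero => simpa [survival] using ⟨hc1, hC1⟩
  | succ n =>
    have e : Real.exp l ^ (n + 1) = Real.exp ((n + 1 : ℝ) * l) := by
      rw [← Real.exp_nat_mul]; push_cast; rfl
    rw [← ENNReal.ofReal_pow (Real.exp_pos l).le, e]
    constructor
    · refine (ENNReal.le_ofReal_iff_toReal_le (ENNReal.mul_ne_top hct (hst _))
        (Real.exp_pos _).le).2 ?_
      rw [← Real.log_le_iff_le_exp (hA _)]
      have := hl1 n
      rw [div_le_iff₀ (by positivity)] at this
      linarith
    · refine (ENNReal.ofReal_le_iff_le_toReal (ENNReal.mul_ne_top hCt (hst _))).2 ?_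
      rw [← Real.le_log_iff_exp_le (hB _)]
      have := hl2 n
      rw [le_div_iff₀ (by positivity)] at this
      linarith

theorem tsum_mul_survival_of_eigenvector {m : ι → ℝ≥0∞} {θ : ℝ≥0∞} (hm : ∑' x, m x = 1)
    (he : ∀ y, ∑' x, m x * p x y = θ * m y) (n : ℕ) :
    ∑' x, m x * survival p n x = θ ^ n := by
  induction n with
  | zero => simpa [survival] using hm
  | succ n ih =>
    rw [tsum_mul_survival_succ]
    simp_rw [he, mul_assoc]
    rw [ENNReal.tsum_mul_left, ih, pow_succ']

theorem eigenvalue_pow_bounds {m : ι → ℝ≥0∞} {θ : ℝ≥0∞} (hp : ∀ x, ∑' y, p x y ≤ 1)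
    (hc : ∀ x, c * ∑' y, p x y ≤ p x x0) (hC : ∀ n x, survival p n x ≤ C * survival p n x0)
    (hm : ∑' x, m x = 1) (hθ : θ ≠ 0) (he : ∀ y, ∑' x, m x * p x y = θ * m y) :
    θ ≤ 1 ∧ ∀ n, c * survival p n x0 ≤ θ ^ n ∧ θ ^ n ≤ C * survival p n x0 := by
  have hS := tsum_mul_survival_of_eigenvector hm he
  have hθ1 : θ ≤ 1 := by
    have := hS 1
    rw [pow_one] at this
    rw [← this, ← hm]
    exact ENNReal.tsum_le_tsum fun x => mul_le_of_le_one_right' (survival_le_one hp 1 x)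
  have hcm : c ≤ m x0 := by
    have h1 : θ * c ≤ θ * m x0 := by
      rw [← he x0, ← pow_one θ, ← hS 1, ← ENNReal.tsum_mul_right]
      refine ENNReal.tsum_le_tsum fun x => ?_
      rw [mul_assoc, survival_one, mul_comm _ c]
      exact mul_le_mul_right (hc x) _
    exact (ENNReal.mul_le_mul_iff_right hθ (ne_top_of_le_ne_top one_ne_top hθ1)).1 h1
  refine ⟨hθ1, fun n => ⟨?_, ?_⟩⟩
  · rw [← hS n]
    exact (mul_le_mul_left hcm _).trans (ENNReal.le_tsum (f := fun x => m x * survival p n x) x0)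
  · calc θ ^ n = ∑' x, m x * survival p n x := (hS n).symm
      _ ≤ ∑' x, m x * (C * survival p n x0) :=
          ENNReal.tsum_le_tsum fun x => mul_le_mul_right (hC n x) _
      _ = _ := by rw [ENNReal.tsum_mul_right, hm, one_mul]

theorem eigenvalue_le {θ₁ θ₂ : ℝ≥0∞} (hc0 : c ≠ 0) (hct : c ≠ ∞) (hCt : C ≠ ∞)
    (h1 : θ₁ ≠ ∞) (h20 : θ₂ ≠ 0) (h2 : θ₂ ≠ ∞) {s : ℕ → ℝ≥0∞}
    (hs1 : ∀ n, θ₁ ^ n ≤ C * s n) (hs2 : ∀ n, c * s n ≤ θ₂ ^ n) : θ₁ ≤ θ₂ := by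
  rw [← ENNReal.toReal_le_toReal h1 h2]
  refine le_of_forall_mul_pow_le (ENNReal.toReal_pos h20 h2) (ENNReal.toReal_pos hc0 hct)
    (C := C.toReal) fun n => ?_
  simp only [← ENNReal.toReal_pow, ← ENNReal.toReal_mul]
  refine ENNReal.toReal_mono (ENNReal.mul_ne_top hCt (ENNReal.pow_ne_top h2)) ?_
  calc c * θ₁ ^ n ≤ c * (C * s n) := mul_le_mul_right (hs1 n) _
    _ = C * (c * s n) := by ring
    _ ≤ _ := mul_le_mul_right (hs2 n) _

theorem tsum_add_ite_mul [DecidableEq ι] (m f : ι → ℝ≥0∞) (a : ℝ≥0∞) :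
    ∑' y, (m y + if y = x0 then a else 0) * f y = ∑' y, m y * f y + a * f x0 := by
  simp_rw [add_mul, ite_mul, zero_mul]
  rw [ENNReal.tsum_add]
  congr 1
  rw [tsum_eq_single x0 (by intro y hy; simp [hy])]
  simp

theorem inv_le_inv_pow_mul {θ s : ℝ≥0∞} (hθ : θ ≠ 0) (hθt : θ ≠ ∞) {n : ℕ}
    (hs : θ ^ n ≤ C * s) : C⁻¹ ≤ θ⁻¹ ^ n * s := by
  rw [ENNReal.inv_le_iff_inv_le, ENNReal.mul_inv
    (Or.inl (ENNReal.pow_ne_zero (by simpa) _)) (Or.inl (ENNReal.pow_ne_top (by simpa))),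
    ← ENNReal.inv_pow, inv_inv, ← div_eq_mul_inv]
  exact ENNReal.div_le_of_le_mul hs

/-- A finite super-eigenvector for a geometric rate of survival has no defect at `x0`. -/
theorem defect_eq_zero_of_add_le [DecidableEq ι] {m : ι → ℝ≥0∞} {θ a : ℝ≥0∞}
    (hθ : θ ≠ 0) (hθt : θ ≠ ∞) (hCt : C ≠ ∞) (hs : ∀ n, θ ^ n ≤ C * survival p n x0)
    (hm : ∑' x, m x ≠ ∞)
    (h : ∀ y, ∑' x, m x * p x y + (if y = x0 then a else 0) ≤ θ * m y) : a = 0 := by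
  have hw : ∀ n, θ⁻¹ ^ (n + 1) * θ = θ⁻¹ ^ n := fun n => by
    rw [pow_succ, mul_assoc, ENNReal.inv_mul_cancel hθ hθt, mul_one]
  have h1 : C⁻¹ * (θ⁻¹ * a) = 0 := by
    refine eq_zero_of_succ_add_le (g := fun n => θ⁻¹ ^ n * ∑' x, m x * survival p n x)
      (by simpa [survival] using hm) fun n => ?_
    have h2 := inv_le_inv_pow_mul hθ hθt (hs n)
    calc θ⁻¹ ^ (n + 1) * ∑' x, m x * survival p (n + 1) x + C⁻¹ * (θ⁻¹ * a)
        ≤ θ⁻¹ ^ (n + 1) * ∑' x, m x * survival p (n + 1) x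
          + θ⁻¹ ^ n * survival p n x0 * (θ⁻¹ * a) := by gcongr
      _ = θ⁻¹ ^ (n + 1) * (∑' y, (∑' x, m x * p x y) * survival p n y
            + a * survival p n x0) := by rw [tsum_mul_survival_succ]; ring
      _ = θ⁻¹ ^ (n + 1) * ∑' y, (∑' x, m x * p x y + if y = x0 then a else 0)
            * survival p n y := by rw [tsum_add_ite_mul]
      _ ≤ θ⁻¹ ^ (n + 1) * ∑' y, θ * m y * survival p n y := by
          gcongr with y; exact h y
      _ = θ⁻¹ ^ n * ∑' x, m x * survival p n x := by
          simp_rw [mul_assoc]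
          rw [ENNReal.tsum_mul_left, ← mul_assoc, hw]
  simpa [hθt, hCt] using h1

/-- A finite sub-eigenvector for a geometric rate of survival has no excess at `x0`. -/
theorem excess_eq_zero_of_le [DecidableEq ι] {m : ι → ℝ≥0∞} {θ a : ℝ≥0∞}
    (hθ : θ ≠ 0) (hθt : θ ≠ ∞) (hc0 : c ≠ 0) (hCt : C ≠ ∞)
    (hC : ∀ n x, survival p n x ≤ C * survival p n x0)
    (hs : ∀ n, c * survival p n x0 ≤ θ ^ n ∧ θ ^ n ≤ C * survival p n x0)
    (hm : ∑' x, m x ≠ ∞)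
    (h : ∀ y, θ * m y + (if y = x0 then a else 0) ≤ ∑' x, m x * p x y) : a = 0 := by
  have hw : ∀ n, θ⁻¹ ^ (n + 1) * θ = θ⁻¹ ^ n := fun n => by
    rw [pow_succ, mul_assoc, ENNReal.inv_mul_cancel hθ hθt, mul_one]
  have hwn : ∀ n, θ⁻¹ ^ n * θ ^ n = 1 := fun n => by
    rw [← mul_pow, ENNReal.inv_mul_cancel hθ hθt, one_pow]
  have h1 : C⁻¹ * (θ⁻¹ * a) = 0 := by
    refine eq_zero_of_add_le_succ (g := fun n => θ⁻¹ ^ n * ∑' x, m x * survival p n x)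
      (B := (C * c⁻¹) * ∑' x, m x)
      (ENNReal.mul_ne_top (ENNReal.mul_ne_top hCt (by simpa)) hm) (fun n => ?_) fun n => ?_
    · have h2 := inv_le_inv_pow_mul hθ hθt (hs n).2
      calc θ⁻¹ ^ n * ∑' x, m x * survival p n x + C⁻¹ * (θ⁻¹ * a)
          ≤ θ⁻¹ ^ n * ∑' x, m x * survival p n x
            + θ⁻¹ ^ n * survival p n x0 * (θ⁻¹ * a) := by gcongr
        _ = θ⁻¹ ^ (n + 1) * (∑' y, θ * m y * survival p n y + a * survival p n x0) := by
            simp_rw [mul_assoc θ]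
            rw [ENNReal.tsum_mul_left, mul_add, ← mul_assoc _ θ, hw]
            ring
        _ = θ⁻¹ ^ (n + 1) * ∑' y, (θ * m y + if y = x0 then a else 0) * survival p n y := by
            rw [tsum_add_ite_mul]
        _ ≤ θ⁻¹ ^ (n + 1) * ∑' y, (∑' x, m x * p x y) * survival p n y := by
            gcongr with y; exact h y
        _ = _ := by rw [tsum_mul_survival_succ]
    · have h3 : survival p n x0 ≤ c⁻¹ * θ ^ n := by
        rw [mul_comm, ← div_eq_mul_inv]
        refine (ENNReal.le_div_iff_mul_le (Or.inl hc0)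
          (Or.inr (ENNReal.pow_ne_top hθt))).2 ?_
        rw [mul_comm]; exact (hs n).1
      calc θ⁻¹ ^ n * ∑' x, m x * survival p n x
          ≤ θ⁻¹ ^ n * ∑' x, m x * (C * (c⁻¹ * θ ^ n)) := by
            gcongr with x
            exact (hC n x).trans (mul_le_mul_right h3 _)
        _ = (θ⁻¹ ^ n * θ ^ n) * ((C * c⁻¹) * ∑' x, m x) := by
            rw [ENNReal.tsum_mul_right]; ring
        _ = _ := by rw [hwn, one_mul]
  simpa [hθt, hCt] using h1

theorem eq_of_le_of_one_le_tsum {m₁ m₂ : ι → ℝ≥0∞} (h : ∀ x, m₁ x ≤ m₂ x)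
    (h1 : 1 ≤ ∑' x, m₁ x) (h2 : ∑' x, m₂ x = 1) : m₁ = m₂ := by
  have h1t : ∑' x, m₁ x ≠ ∞ :=
    ne_top_of_le_ne_top one_ne_top ((ENNReal.tsum_le_tsum h).trans h2.le)
  have h3 : ∑' x, (m₂ x - m₁ x) = 0 := by
    refine le_antisymm ?_ bot_le
    refine (ENNReal.add_le_add_iff_left h1t).1 ?_
    rw [← ENNReal.tsum_add, add_zero, tsum_congr fun x => add_tsub_cancel_of_le (h x), h2]
    exact h1
  funext x
  exact le_antisymm (h x) (tsub_eq_zero_iff_le.1 (ENNReal.tsum_eq_zero.1 h3 x))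

/-- Uniqueness of the normalized nonnegative left eigenvector with nonzero eigenvalue. -/
theorem eigenvector_unique (hp : ∀ x, ∑' y, p x y ≤ 1)
    (hc0 : c ≠ 0) (hct : c ≠ ∞) (hc : ∀ x, c * ∑' y, p x y ≤ p x x0)
    (hCt : C ≠ ∞) (hC : ∀ n x, survival p n x ≤ C * survival p n x0)
    {m₁ m₂ : ι → ℝ≥0∞} {θ₁ θ₂ : ℝ≥0∞} (hm₁ : ∑' x, m₁ x = 1) (hm₂ : ∑' x, m₂ x = 1)
    (hθ₁ : θ₁ ≠ 0) (hθ₂ : θ₂ ≠ 0) (he₁ : ∀ y, ∑' x, m₁ x * p x y = θ₁ * m₁ y)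
    (he₂ : ∀ y, ∑' x, m₂ x * p x y = θ₂ * m₂ y) : m₁ = m₂ := by
  classical
  obtain ⟨hθ₁', hs₁⟩ := eigenvalue_pow_bounds hp hc hC hm₁ hθ₁ he₁
  obtain ⟨hθ₂', hs₂⟩ := eigenvalue_pow_bounds hp hc hC hm₂ hθ₂ he₂
  have ht₁ := ne_top_of_le_ne_top one_ne_top hθ₁'
  have ht₂ := ne_top_of_le_ne_top one_ne_top hθ₂'
  obtain rfl : θ₁ = θ₂ := le_antisymm
    (eigenvalue_le hc0 hct hCt ht₁ hθ₂ ht₂ (fun n => (hs₁ n).2) fun n => (hs₂ n).1)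
    (eigenvalue_le hc0 hct hCt ht₂ hθ₁ ht₁ (fun n => (hs₂ n).2) fun n => (hs₁ n).1)
  set θ := θ₁
  set k : ι → ℝ≥0∞ := fun x => min (m₁ x) (m₂ x)
  have hk₁ : ∀ x, k x ≤ m₁ x := fun x => min_le_left _ _
  have hk₂ : ∀ x, k x ≤ m₂ x := fun x => min_le_right _ _
  have hkt : ∑' x, k x ≠ ∞ := ne_top_of_le_ne_top one_ne_top
    ((ENNReal.tsum_le_tsum hk₁).trans hm₁.le)
  have split : ∀ {m : ι → ℝ≥0∞}, (∀ x, k x ≤ m x) → (∀ y, ∑' x, m x * p x y = θ * m y) →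
      ∀ y, ∑' x, k x * p x y + ∑' x, (m x - k x) * p x y = θ * m y := by
    intro m hk he y
    rw [← he y, ← ENNReal.tsum_add]
    refine tsum_congr fun x => ?_
    rw [← add_mul, add_tsub_cancel_of_le (hk x)]
  set a := min (∑' x, (m₁ x - k x) * p x x0) (∑' x, (m₂ x - k x) * p x x0)
  have ha : a = 0 := by
    refine defect_eq_zero_of_add_le (m := k) hθ₁ ht₁ hCt (fun n => (hs₁ n).2) hkt fun y => ?_
    rw [show θ * k y = min (θ * m₁ y) (θ * m₂ y) from mul_min _ _ _]
    rw [← split hk₁ he₁ y, ← split hk₂ he₂ y]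
    split_ifs with hy
    · subst hy
      exact le_min (add_le_add_right (min_le_left _ _) _) (add_le_add_right (min_le_right _ _) _)
    · simp
  have key : ∀ {m : ι → ℝ≥0∞}, (∀ x, k x ≤ m x) → (∑' x, m x = 1) →
      (∀ y, ∑' x, m x * p x y = θ * m y) → ∑' x, (m x - k x) * p x x0 = 0 →
      1 ≤ ∑' x, k x := by
    intro m hk hm he h0
    have h1 : ∀ x y, (m x - k x) * p x y = 0 := by
      intro x y
      have h2 : c * ((m x - k x) * p x y) ≤ 0 := by
        rw [← ENNReal.tsum_eq_zero.1 h0 x, mul_left_comm]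
        exact mul_le_mul_right ((mul_le_mul_right (ENNReal.le_tsum y) _).trans (hc x)) _
      simpa [hc0] using h2
    have h3 : ∀ y, θ * m y ≤ θ * k y := by
      intro y
      rw [← split hk he y]
      simp only [h1, tsum_zero, add_zero]
      rw [show θ * k y = min (θ * m₁ y) (θ * m₂ y) from mul_min _ _ _, ← he₁ y, ← he₂ y]
      exact le_min (ENNReal.tsum_le_tsum fun x => mul_le_mul_left (hk₁ x) _)
        (ENNReal.tsum_le_tsum fun x => mul_le_mul_left (hk₂ x) _)
    rw [← hm]
    exact ENNReal.tsum_le_tsum fun y => (ENNReal.mul_le_mul_iff_right hθ₁ ht₁).1 (h3 y)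
  have hk1 : 1 ≤ ∑' x, k x := by
    rcases min_eq_bot.1 ha with h | h
    · exact key hk₁ hm₁ he₁ h
    · exact key hk₂ hm₂ he₂ h
  rw [← eq_of_le_of_one_le_tsum hk₁ hk1 hm₁, ← eq_of_le_of_one_le_tsum hk₂ hk1 hm₂]

/-- Taboo expansion at `x0`: the weighted laws of the kernel `r` started from `x0`. -/
def tabooLaw [DecidableEq ι] (r : ι → ι → ℝ≥0∞) (x0 : ι) (w : ℝ≥0∞) : ℕ → ι → ℝ≥0∞
  | 0, y => if y = x0 then w else 0
  | n + 1, y => w * ∑' x, tabooLaw r x0 w n x * r x y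

theorem tabooLaw_mass_succ [DecidableEq ι] (r : ι → ι → ℝ≥0∞) (w : ℝ≥0∞) (n : ℕ) :
    ∑' y, tabooLaw r x0 w (n + 1) y = w * ∑' x, tabooLaw r x0 w n x * ∑' y, r x y := by
  simp_rw [tabooLaw]
  rw [ENNReal.tsum_mul_left, ENNReal.tsum_comm]
  simp_rw [ENNReal.tsum_mul_left]

theorem tabooLaw_mass_ne_top [DecidableEq ι] {r : ι → ι → ℝ≥0∞} {w : ℝ≥0∞} (hw : w ≠ ∞)
    (hr : ∀ x, ∑' y, r x y ≤ 1) (n : ℕ) : ∑' y, tabooLaw r x0 w n y ≠ ∞ := by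
  induction n with
  | zero => simpa [tabooLaw] using hw
  | succ n ih =>
    rw [tabooLaw_mass_succ]
    refine ENNReal.mul_ne_top hw (ne_top_of_le_ne_top ih ?_)
    exact ENNReal.tsum_le_tsum fun x => mul_le_of_le_one_right' (hr x)

/-- Existence of a normalized nonnegative left eigenvector with nonzero eigenvalue. -/
theorem exists_eigenvector (hp : ∀ x, ∑' y, p x y ≤ 1)
    (hc0 : c ≠ 0) (hc : ∀ x, c * ∑' y, p x y ≤ p x x0)
    (hCt : C ≠ ∞) (hC : ∀ n x, survival p n x ≤ C * survival p n x0)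
    (hpos : ∀ n, survival p n x0 ≠ 0) :
    ∃ (m : ι → ℝ≥0∞) (θ : ℝ≥0∞), ∑' x, m x = 1 ∧ θ ≠ 0 ∧
      ∀ y, ∑' x, m x * p x y = θ * m y := by
  classical
  obtain ⟨θ, hθ, hθt, hs⟩ := exists_geometric_survival hp hc0 hc hCt hC hpos
  have hct : c ≠ ∞ := ne_top_of_le_ne_top one_ne_top (doeblin_const_le_one hp hc hpos)
  set w := θ⁻¹
  have hw0 : w ≠ 0 := by simpa [w] using hθt
  have hwt : w ≠ ∞ := by simpa [w] using hθ
  have hθw : θ * w = 1 := ENNReal.mul_inv_cancel hθ hθt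
  set q : ι → ℝ≥0∞ := fun x => c * ∑' y, p x y
  set r : ι → ι → ℝ≥0∞ := fun x y => p x y - if y = x0 then q x else 0
  have hpr : ∀ x y, p x y = r x y + if y = x0 then q x else 0 := by
    intro x y
    refine (tsub_add_cancel_of_le ?_).symm
    split_ifs with hy
    · exact hy ▸ hc x
    · exact zero_le
  have hrp : ∀ x, ∑' y, r x y ≤ ∑' y, p x y := fun x =>
    ENNReal.tsum_le_tsum fun y => tsub_le_self
  have hr1 : ∀ x, ∑' y, r x y ≤ 1 := fun x => (hrp x).trans (hp x)
  have hrq : ∀ x, ∑' y, r x y ≤ c⁻¹ * q x := fun x => by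
    simpa [q, ← mul_assoc, ENNReal.inv_mul_cancel hc0 hct] using hrp x
  have hmp : ∀ (m : ι → ℝ≥0∞) (y : ι), ∑' x, m x * p x y
      = ∑' x, m x * r x y + if y = x0 then ∑' x, m x * q x else 0 := by
    intro m y
    simp_rw [hpr, mul_add]
    rw [ENNReal.tsum_add]
    split_ifs <;> simp
  set h := tabooLaw r x0 w
  have hht : ∀ n, ∑' y, h n y ≠ ∞ := tabooLaw_mass_ne_top hwt hr1
  set H : ι → ℝ≥0∞ := fun y => ∑' n, h n y
  set F := ∑' x, H x * q x
  have hH : ∀ y, θ * H y = ∑' x, H x * r x y + if y = x0 then 1 else 0 := by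
    intro y
    have h1 : H y = (if y = x0 then w else 0) + w * ∑' x, H x * r x y := by
      simp only [H]
      rw [tsum_eq_zero_add' ENNReal.summable]
      simp_rw [← ENNReal.tsum_mul_right]
      rw [ENNReal.tsum_comm, ← ENNReal.tsum_mul_left]
      rfl
    rw [h1, mul_add, ← mul_assoc, hθw, one_mul, mul_ite, hθw, mul_zero, add_comm]
  have hF : F = ∑' n, ∑' x, h n x * q x := by
    simp only [F, H, ← ENNReal.tsum_mul_right]
    exact ENNReal.tsum_comm
  have hF1 : F ≤ 1 := by
    by_contra! hlt
    rw [hF, ENNReal.tsum_eq_iSup_nat] at hlt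
    obtain ⟨N, hN⟩ := lt_iSup_iff.1 hlt
    set G : ι → ℝ≥0∞ := fun y => ∑ n ∈ Finset.range N, h n y
    have hG : ∀ y, θ * G y ≤ ∑' x, G x * r x y + if y = x0 then 1 else 0 := by
      intro y
      have h1 : G y ≤ (if y = x0 then w else 0) + w * ∑' x, G x * r x y := by
        calc G y ≤ ∑ n ∈ Finset.range (N + 1), h n y :=
              Finset.sum_le_sum_of_subset (Finset.range_mono N.le_succ)
          _ = _ := by
            rw [Finset.sum_range_succ', add_comm]
            simp only [G, Finset.sum_mul]
            rw [Summable.tsum_finsetSum fun _ _ => ENNReal.summable, Finset.mul_sum]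
            rfl
      refine (mul_le_mul_right h1 θ).trans_eq ?_
      rw [mul_add, ← mul_assoc, hθw, one_mul, mul_ite, hθw, mul_zero, add_comm]
    have hGq : ∑ n ∈ Finset.range N, ∑' x, h n x * q x = ∑' x, G x * q x := by
      simp only [G, Finset.sum_mul]
      rw [Summable.tsum_finsetSum fun _ _ => ENNReal.summable]
    rw [hGq] at hN
    have hGt : ∑' y, G y ≠ ∞ := by
      simp only [G]
      rw [Summable.tsum_finsetSum fun _ _ => ENNReal.summable]
      exact ENNReal.sum_ne_top.2 fun n _ => hht n
    have := excess_eq_zero_of_le (a := ∑' x, G x * q x - 1) hθ hθt hc0 hCt hC hs hGt fun y => by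
      rw [hmp]
      refine (add_le_add_left (hG y) _).trans_eq ?_
      rw [add_assoc]
      split_ifs
      · rw [add_tsub_cancel_of_le hN.le]
      · simp
    exact absurd (tsub_eq_zero_iff_le.1 this) (not_le.2 hN)
  have hHt : ∑' y, H y ≠ ∞ := by
    have h1 : ∑' y, H y ≤ w + w * (c⁻¹ * F) := by
      simp only [H]
      rw [ENNReal.tsum_comm, tsum_eq_zero_add' ENNReal.summable, hF]
      refine add_le_add (by simp [h, tabooLaw]) ?_
      rw [← ENNReal.tsum_mul_left, ← ENNReal.tsum_mul_left]
      refine ENNReal.tsum_le_tsum fun n => ?_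
      rw [tabooLaw_mass_succ]
      refine mul_le_mul_right ?_ w
      rw [← ENNReal.tsum_mul_left]
      refine ENNReal.tsum_le_tsum fun x => ?_
      rw [mul_left_comm]
      exact mul_le_mul_right (hrq x) _
    refine ne_top_of_le_ne_top ?_ h1
    exact ENNReal.add_ne_top.2 ⟨hwt, ENNReal.mul_ne_top hwt (ENNReal.mul_ne_top (by simpa)
      (ne_top_of_le_ne_top one_ne_top hF1))⟩
  have hF2 : F = 1 := by
    refine le_antisymm hF1 (tsub_eq_zero_iff_le.1 ?_)
    refine defect_eq_zero_of_add_le (m := H) hθ hθt hCt (fun n => (hs n).2) hHt fun y => ?_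
    rw [hmp, hH, add_assoc]
    split_ifs
    · rw [add_tsub_cancel_of_le hF1]
    · simp
  have hHe : ∀ y, ∑' x, H x * p x y = θ * H y := fun y => by
    rw [hmp, hH, show ∑' x, H x * q x = 1 from hF2]
  have hH0 : ∑' y, H y ≠ 0 := by
    intro h0
    have h1 := ENNReal.tsum_eq_zero.1 (ENNReal.tsum_eq_zero.1 h0 x0) 0
    simp [h, tabooLaw, hw0] at h1
  refine ⟨fun y => (∑' x, H x)⁻¹ * H y, θ, ?_, hθ, fun y => ?_⟩
  · rw [ENNReal.tsum_mul_left, ENNReal.inv_mul_cancel hH0 hHt]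
  · simp_rw [mul_assoc]
    rw [ENNReal.tsum_mul_left, hHe, mul_left_comm]

end Kernel

namespace AbsorbedProcess

variable (M : AbsorbedProcess Ω)

instance (x : ℕ) : IsProbabilityMeasure (M.P x) := M.prob x

theorem measurableSet_eq (t : ℝ≥0) (y : ℕ) : MeasurableSet {ω | M.X t ω = y} :=
  M.meas t (measurableSet_singleton y)

theorem measurableSet_ne_zero (t : ℝ≥0) : MeasurableSet {ω | M.X t ω ≠ 0} :=
  (M.measurableSet_eq t 0).compl

theorem measurable_shifted_path (s : ℝ≥0) : Measurable fun ω u => M.X (s + u) ω :=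
  measurable_pi_lambda _ fun u => M.meas (s + u)

theorem measurable_path : Measurable fun ω u => M.X u ω :=
  measurable_pi_lambda _ fun u => M.meas u

theorem ae_init (x : ℕ) : ∀ᵐ ω ∂M.P x, M.X 0 ω = x :=
  (prob_compl_eq_zero_iff (M.measurableSet_eq 0 x)).2 (M.init x)

theorem tsum_measure_eq_inter (μ : Measure Ω) (t : ℝ≥0) {A : Set Ω} (hA : MeasurableSet A) :
    ∑' y, μ ({ω | M.X t ω = y} ∩ A) = μ A := by
  rw [← measure_iUnion _ fun y => (M.measurableSet_eq t y).inter hA]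
  · congr 1; ext ω; simp
  · intro y z hyz
    refine Set.disjoint_left.2 fun ω h1 h2 => hyz ?_
    exact h1.1.symm.trans h2.1

theorem map_shifted_path (x : ℕ) (s : ℝ≥0) :
    (M.P x).map (fun ω u => M.X (s + u) ω)
      = Measure.sum fun z => M.P x {ω | M.X s ω = z} • (M.P z).map fun ω u => M.X u ω := by
  ext B hB
  rw [Measure.map_apply (M.measurable_shifted_path s) hB, Measure.sum_apply _ hB,
    ← M.tsum_measure_eq_inter (M.P x) s (M.measurable_shifted_path s hB)]
  refine tsum_congr fun z => ?_
  rw [Measure.smul_apply, Measure.map_apply M.measurable_path hB, smul_eq_mul]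
  exact M.markov x z s B hB

theorem lintegral_shifted_path (x : ℕ) (s : ℝ≥0) {F : (ℝ≥0 → ℕ) → ℝ≥0∞} (hF : Measurable F) :
    ∫⁻ ω, F (fun u => M.X (s + u) ω) ∂M.P x
      = ∑' z, M.P x {ω | M.X s ω = z} * ∫⁻ ω, F (fun u => M.X u ω) ∂M.P z := by
  rw [← lintegral_map hF (M.measurable_shifted_path s), M.map_shifted_path, lintegral_sum_measure]
  refine tsum_congr fun z => ?_
  rw [lintegral_smul_measure, lintegral_map hF M.measurable_path, smul_eq_mul]

theorem measure_add_mem (x : ℕ) (s t : ℝ≥0) (A : Set ℕ) :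
    M.P x {ω | M.X (s + t) ω ∈ A} = ∑' z, M.P x {ω | M.X s ω = z} * M.P z {ω | M.X t ω ∈ A} := by
  have hA : MeasurableSet A := A.to_countable.measurableSet
  have h := M.lintegral_shifted_path x s
    (F := fun w => A.indicator 1 (w t))
    ((measurable_one.indicator hA).comp (measurable_pi_apply t))
  have h1 : ∀ (y : ℕ) (r : ℝ≥0), ∫⁻ ω, A.indicator (1 : ℕ → ℝ≥0∞) (M.X r ω) ∂M.P y
      = M.P y {ω | M.X r ω ∈ A} := fun y r => by
    exact lintegral_indicator_one (M.meas r hA)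
  simpa only [h1] using h

/-- The sub-Markovian transition function of the process before absorption. -/
def trans (t : ℝ≥0) (x y : ℕ) : ℝ≥0∞ := if y = 0 then 0 else M.P x {ω | M.X t ω = y}

/-- The probability of not being absorbed at time `t`. -/
def surv (t : ℝ≥0) (x : ℕ) : ℝ≥0∞ := M.P x {ω | M.X t ω ≠ 0}

theorem surv_le_one (t : ℝ≥0) (x : ℕ) : M.surv t x ≤ 1 := prob_le_one

theorem surv_zero_right (t : ℝ≥0) : M.surv t 0 = 0 := by
  refine measure_mono_null (t := {ω | ¬(M.X 0 ω = 0 ∧ ∀ s t : ℝ≥0, s ≤ t → M.X s ω = 0 →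
    M.X t ω = 0)}) ?_ ((M.ae_init 0).and (M.absorbing 0))
  intro ω h h'
  exact h (h'.2 0 t zero_le h'.1)

theorem surv_zero_left {x : ℕ} (hx : x ≠ 0) : M.surv 0 x = 1 := by
  refine (prob_compl_eq_zero_iff ?_).1 ?_
  · exact M.measurableSet_ne_zero 0
  · filter_upwards [M.ae_init x] with ω h
    simpa [h] using hx

theorem trans_eq_measure_inter (t : ℝ≥0) (x y : ℕ) :
    M.trans t x y = M.P x ({ω | M.X t ω = y} ∩ {ω | M.X t ω ≠ 0}) := by
  unfold trans
  split_ifs with hy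
  · subst hy
    rw [eq_comm, ← measure_empty (μ := M.P x)]
    congr 1; ext ω; simp
  · congr 1; ext ω
    simp only [mem_ofPred_eq, mem_inter_iff, ne_eq]
    exact ⟨fun h => ⟨h, h ▸ hy⟩, fun h => h.1⟩

theorem tsum_trans (t : ℝ≥0) (x : ℕ) : ∑' y, M.trans t x y = M.surv t x := by
  simp_rw [trans_eq_measure_inter]
  exact M.tsum_measure_eq_inter _ t (M.measurableSet_ne_zero t)

theorem surv_add (s t : ℝ≥0) (x : ℕ) :
    M.surv (s + t) x = ∑' z, M.trans s x z * M.surv t z := by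
  refine (M.measure_add_mem x s t {0}ᶜ).trans (tsum_congr fun z => ?_)
  change _ * M.surv t z = _
  unfold trans
  split_ifs with hz
  · rw [hz, surv_zero_right]; simp
  · rfl

theorem trans_add (s t : ℝ≥0) (x y : ℕ) :
    M.trans (s + t) x y = ∑' z, M.trans s x z * M.trans t z y := by
  by_cases hy : y = 0
  · simp [trans, hy]
  have h0 : M.trans t 0 y = 0 := by
    refine le_antisymm ?_ bot_le
    rw [← M.surv_zero_right t, ← tsum_trans]
    exact ENNReal.le_tsum y
  have h1 : ∀ (r : ℝ≥0) (z : ℕ), M.trans r z y = M.P z {ω | M.X r ω ∈ ({y} : Set ℕ)} :=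
    fun r z => if_neg hy
  rw [h1, M.measure_add_mem]
  refine tsum_congr fun z => ?_
  rw [← h1]
  by_cases hz : z = 0
  · simp [hz, h0]
  · simp [trans, hz]

theorem survival_trans_one (n : ℕ) (x : ℕ) :
    survival (M.trans 1) (n + 1) x = M.surv (n + 1) x := by
  induction n generalizing x with
  | zero => simp [survival_one, tsum_trans]
  | succ n ih =>
    rw [survival]
    simp_rw [ih]
    rw [← M.surv_add]
    push_cast
    rw [add_comm]

theorem alive_ae_eq (t : ℝ≥0) (x : ℕ) :
    ∀ᵐ ω ∂M.P x, ω ∈ alive M t ↔ ω ∈ {ω | M.X t ω ≠ 0} := by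
  filter_upwards [M.rightCont x, M.absorbing x] with ω hr ha
  constructor
  · intro h h0
    exact absurd (iInf_le (fun t : {t : ℝ≥0 // M.X t ω ∈ ({0} : Set ℕ)} => (t.1 : ℝ≥0∞)) ⟨t, h0⟩)
      (not_le.2 h)
  · intro h
    obtain ⟨ε, hε, h1⟩ := hr t
    have h2 : ((t + ε : ℝ≥0) : ℝ≥0∞) ≤ hitT M {0} ω := by
      refine le_iInf fun s => ?_
      have hs : M.X s.1 ω = 0 := s.2
      rw [ENNReal.coe_le_coe]
      by_contra! hlt
      rcases le_total t s.1 with hts | hts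
      · exact h ((h1 s.1 hts hlt).symm.trans hs)
      · exact h (ha _ _ hts hs)
    exact lt_of_lt_of_le (ENNReal.coe_lt_coe.2 (lt_add_of_pos_right t hε)) h2

theorem measure_alive (t : ℝ≥0) (x : ℕ) : M.P x (alive M t) = M.surv t x :=
  measure_congr (eventuallyEq_set.2 (M.alive_ae_eq t x))

theorem Pmu_eq_sum (μ : Measure ℕ) : Pmu M μ = Measure.sum fun x => μ {x} • M.P x := by
  ext A hA
  rw [Pmu, Measure.bind_apply hA (measurable_of_countable _).aemeasurable, lintegral_countable',
    Measure.sum_apply _ hA]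
  simp [mul_comm]

theorem Pmu_apply (μ : Measure ℕ) {A : Set Ω} (hA : MeasurableSet A) :
    Pmu M μ A = ∑' x, μ {x} * M.P x A := by
  simp [Pmu_eq_sum, Measure.sum_apply _ hA]

theorem alive_ae_eq_Pmu (μ : Measure ℕ) (t : ℝ≥0) :
    alive M t =ᵐ[Pmu M μ] {ω | M.X t ω ≠ 0} := by
  rw [Pmu_eq_sum, eventuallyEq_set, Measure.ae_sum_iff]
  exact fun x => Measure.ae_smul_measure (M.alive_ae_eq t x) _

theorem Pmu_alive (μ : Measure ℕ) (t : ℝ≥0) :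
    Pmu M μ (alive M t) = ∑' x, μ {x} * M.surv t x := by
  rw [measure_congr (M.alive_ae_eq_Pmu μ t), M.Pmu_apply μ (M.measurableSet_ne_zero t)]
  rfl

theorem condDist_singleton (μ : Measure ℕ) (t : ℝ≥0) (y : ℕ) :
    condDist M μ t {y}
      = (∑' x, μ {x} * M.surv t x)⁻¹ * ∑' x, μ {x} * M.trans t x y := by
  rw [condDist, Measure.smul_apply, Measure.map_apply (M.meas t) (measurableSet_singleton y),
    Pmu_alive, Measure.restrict_congr_set (M.alive_ae_eq_Pmu μ t),
    Measure.restrict_apply (M.meas t (measurableSet_singleton y)),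
    M.Pmu_apply μ ((M.meas t (measurableSet_singleton y)).inter (M.measurableSet_ne_zero t))]
  simp_rw [trans_eq_measure_inter]
  rfl

/-- The exponential of `l h` times the number of grid steps of mesh `h`, capped at the given
integer, before a path visits `D`. -/
def gridExp (D : Set ℕ) (l : ℝ) (h : ℝ≥0) : ℕ → (ℝ≥0 → ℕ) → ℝ≥0∞
  | 0, _ => 1
  | n + 1, w => open Classical in
      if w 0 ∈ D then 1 else ENNReal.ofReal (Real.exp (l * h)) * gridExp D l h n fun u => w (h + u)

theorem measurable_gridExp (D : Set ℕ) (l : ℝ) (h : ℝ≥0) (n : ℕ) :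
    Measurable (gridExp D l h n) := by
  induction n with
  | zero => exact measurable_const
  | succ n ih =>
    have hD : MeasurableSet D := D.to_countable.measurableSet
    refine Measurable.ite (measurable_pi_apply (0 : ℝ≥0) hD) measurable_const ?_
    exact (ih.comp (measurable_pi_lambda _ fun u => measurable_pi_apply (h + u))).const_mul _

theorem one_le_ofReal_exp {l : ℝ} (hl : 0 ≤ l) (a : ℝ≥0) :
    1 ≤ ENNReal.ofReal (Real.exp (l * a)) := by
  rw [← ENNReal.ofReal_one]
  exact ENNReal.ofReal_le_ofReal (Real.one_le_exp (mul_nonneg hl a.2))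

theorem ofReal_exp_add (l : ℝ) (a b : ℝ≥0) :
    ENNReal.ofReal (Real.exp (l * (a + b : ℝ≥0)))
      = ENNReal.ofReal (Real.exp (l * a)) * ENNReal.ofReal (Real.exp (l * b)) := by
  rw [← ENNReal.ofReal_mul (Real.exp_pos _).le, ← Real.exp_add, NNReal.coe_add, mul_add]

theorem gridExp_le {D : Set ℕ} {l : ℝ} (hl : 0 ≤ l) (h : ℝ≥0) (n : ℕ) (w : ℝ≥0 → ℕ) :
    gridExp D l h n w ≤ ENNReal.ofReal (Real.exp (l * (n * h : ℝ≥0))) := by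
  induction n generalizing w with
  | zero => exact one_le_ofReal_exp hl _
  | succ n ih =>
    rw [gridExp]
    split_ifs
    · exact one_le_ofReal_exp hl _
    · rw [Nat.cast_succ, add_mul, one_mul, add_comm, ofReal_exp_add]
      exact mul_le_mul_right (ih _) _

theorem gridExp_le_of_mem {D : Set ℕ} {l : ℝ} (hl : 0 ≤ l) (h : ℝ≥0) (n j : ℕ) (w : ℝ≥0 → ℕ)
    (hj : w (j * h) ∈ D) :
    gridExp D l h n w ≤ ENNReal.ofReal (Real.exp (l * (j * h : ℝ≥0))) := by
  induction n generalizing w j with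
  | zero => exact one_le_ofReal_exp hl _
  | succ n ih =>
    rw [gridExp]
    split_ifs with h0
    · exact one_le_ofReal_exp hl _
    · cases j with
      | zero => simp at hj; exact absurd hj h0
      | succ j =>
        rw [Nat.cast_succ, add_mul, one_mul, add_comm] at hj ⊢
        rw [ofReal_exp_add]
        exact mul_le_mul_right (ih j _ hj) _

theorem eventually_gridExp_le {K : Set ℕ} {l : ℝ} (hl : 0 ≤ l) {T : ℝ≥0} (hT : 0 < T) {ω : Ω}
    (hr : ∀ t : ℝ≥0, ∃ ε : ℝ≥0, 0 < ε ∧ ∀ s : ℝ≥0, t ≤ s → s < t + ε → M.X s ω = M.X t ω) :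
    ∀ᶠ N : ℕ in atTop, gridExp (insert 0 K) l (T / (N + 1)) (N + 1) (fun u => M.X u ω)
      ≤ ENNReal.ofReal (Real.exp (l * (1 : ℝ≥0))) * expE l (min (hitT M K ω) (hitT M {0} ω)) := by
  set τ := min (hitT M K ω) (hitT M {0} ω) with hτ
  by_cases hτt : τ = ∞
  · refine Eventually.of_forall fun N => ?_
    rw [hτt, expE, if_pos rfl, ENNReal.mul_top (by simp [Real.exp_pos])]
    exact le_top
  lift τ to ℝ≥0 using hτt with τ'
  have hhalf : (0 : ℝ≥0) < 1 / 2 := by positivity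
  obtain ⟨s, hsD, hs⟩ : ∃ s : ℝ≥0, M.X s ω ∈ insert 0 K ∧ s < τ' + 1 / 2 := by
    have h1 : min (hitT M K ω) (hitT M {0} ω) < ((τ' + 1 / 2 : ℝ≥0) : ℝ≥0∞) := by
      rw [← hτ]
      exact ENNReal.coe_lt_coe.2 (lt_add_of_pos_right τ' hhalf)
    rcases min_lt_iff.1 h1 with h | h
    · obtain ⟨s, hs⟩ := iInf_lt_iff.1 h
      exact ⟨s.1, Or.inr s.2, ENNReal.coe_lt_coe.1 hs⟩
    · obtain ⟨s, hs⟩ := iInf_lt_iff.1 h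
      exact ⟨s.1, Or.inl s.2, ENNReal.coe_lt_coe.1 hs⟩
  obtain ⟨ε, hε, hsε⟩ := hr s
  have hlim : Tendsto (fun N : ℕ => T / ((N : ℝ≥0) + 1)) atTop (nhds 0) := by
    have := (tendsto_one_div_add_atTop_nhds_zero_nat (𝕜 := ℝ≥0)).const_mul T
    simpa [div_eq_mul_inv] using this
  filter_upwards [hlim.eventually_lt_const (lt_min hε hhalf)] with N hN
  set h : ℝ≥0 := T / (N + 1)
  have hh : 0 < h := by positivity
  have hj1 : s ≤ ⌈s / h⌉₊ * h := (div_le_iff₀ hh).1 (Nat.le_ceil _)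
  have hj2 : ⌈s / h⌉₊ * h < s + h := by
    have := mul_lt_mul_of_pos_right (Nat.ceil_lt_add_one (zero_le (a := s / h))) hh
    rwa [add_mul, one_mul, div_mul_cancel₀ _ hh.ne'] at this
  have hmem : M.X (⌈s / h⌉₊ * h) ω ∈ insert 0 K := by
    rw [hsε _ hj1 (hj2.trans (add_lt_add_right (hN.trans_le (min_le_left _ _)) s))]
    exact hsD
  refine (gridExp_le_of_mem hl h (N + 1) ⌈s / h⌉₊ (fun u => M.X u ω) hmem).trans ?_
  rw [expE, if_neg coe_ne_top, ENNReal.coe_toReal, ← ofReal_exp_add]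
  refine ENNReal.ofReal_le_ofReal (Real.exp_le_exp.2 (mul_le_mul_of_nonneg_left ?_ hl))
  rw [NNReal.coe_le_coe]
  calc ⌈s / h⌉₊ * h ≤ s + h := hj2.le
    _ ≤ (τ' + 1 / 2) + 1 / 2 := add_le_add hs.le (hN.le.trans (min_le_right _ _))
    _ = 1 + τ' := by rw [add_assoc, add_halves, add_comm]

theorem exists_lintegral_gridExp_lt {K : Set ℕ} {l : ℝ} (hl : 0 ≤ l) {T : ℝ≥0} (hT : 0 < T)
    {x : ℕ} {k : ℝ≥0∞} (hk : k ≠ ∞)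
    (h4 : ∫⁻ ω, expE l (min (hitT M K ω) (hitT M {0} ω)) ∂M.P x ≤ k) :
    ∃ N : ℕ, ∫⁻ ω, gridExp (insert 0 K) l (T / (N + 1)) (N + 1) (fun u => M.X u ω) ∂M.P x
      ≤ ENNReal.ofReal (Real.exp (l * (1 : ℝ≥0))) * k + 1 := by
  set e := ENNReal.ofReal (Real.exp (l * (1 : ℝ≥0)))
  set f : ℕ → Ω → ℝ≥0∞ := fun N ω =>
    gridExp (insert 0 K) l (T / (N + 1)) (N + 1) (fun u => M.X u ω)
  have hNT : ∀ N : ℕ, ((N + 1 : ℕ) : ℝ≥0) * (T / (N + 1)) = T := fun N => by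
    push_cast
    exact mul_div_cancel₀ _ (by positivity)
  have hlim : limsup (fun N => ∫⁻ ω, f N ω ∂M.P x) atTop ≤ e * k := by
    calc limsup (fun N => ∫⁻ ω, f N ω ∂M.P x) atTop
        ≤ ∫⁻ ω, limsup (fun N => f N ω) atTop ∂M.P x := by
          refine limsup_lintegral_le (fun _ => ENNReal.ofReal (Real.exp (l * T)))
            (fun N => (measurable_gridExp _ _ _ _).comp M.measurable_path)
            (fun N => Eventually.of_forall fun ω => ?_) (by simp)
          simpa only [hNT] using gridExp_le hl (T / (N + 1)) (N + 1) fun u => M.X u ω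
      _ ≤ ∫⁻ ω, e * expE l (min (hitT M K ω) (hitT M {0} ω)) ∂M.P x := by
          refine lintegral_mono_ae ?_
          filter_upwards [M.rightCont x] with ω hω
          exact limsup_le_of_le (by isBoundedDefault) (M.eventually_gridExp_le hl hT hω)
      _ = e * ∫⁻ ω, expE l (min (hitT M K ω) (hitT M {0} ω)) ∂M.P x :=
          lintegral_const_mul' _ _ ofReal_ne_top
      _ ≤ e * k := mul_le_mul_right h4 _
  have hlt : limsup (fun N => ∫⁻ ω, f N ω ∂M.P x) atTop < e * k + 1 :=
    hlim.trans_lt (ENNReal.lt_add_right (ENNReal.mul_ne_top ofReal_ne_top hk) one_ne_zero)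
  obtain ⟨N, hN⟩ := (eventually_lt_of_limsup_lt hlt).exists
  exact ⟨N, hN.le⟩

section SurvivalBound

variable {K : Set ℕ} {x0 : ℕ} {l : ℝ} {k2 k3 : ℝ≥0∞}

theorem surv_le_surv_add (hK : 0 ∉ K) (hx0 : x0 ∈ K)
    (h2 : ∀ t, ∀ x ∈ K, ∀ y ∈ K, k2 * M.surv t y ≤ M.surv t x)
    (h3 : ∀ t : ℝ≥0, k3 ≤ M.P x0 {ω | M.X t ω ∈ K} * ENNReal.ofReal (Real.exp (l * t)))
    (s a : ℝ≥0) :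
    k2 * k3 * M.surv s x0 ≤ M.surv (s + a) x0 * ENNReal.ofReal (Real.exp (l * a)) := by
  have hKm : MeasurableSet {ω | M.X a ω ∈ K} := M.meas a K.to_countable.measurableSet
  have h : M.P x0 {ω | M.X a ω ∈ K} * (k2 * M.surv s x0) ≤ M.surv (s + a) x0 := by
    rw [add_comm, M.surv_add, ← M.tsum_measure_eq_inter _ a hKm, ← ENNReal.tsum_mul_right]
    refine ENNReal.tsum_le_tsum fun z => ?_
    by_cases hz : z ∈ K
    · refine mul_le_mul' ?_ (h2 s z hz x0 hx0)
      rw [trans, if_neg (by rintro rfl; exact hK hz)]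
      exact measure_mono inter_subset_left
    · rw [show {ω | M.X a ω = z} ∩ {ω | M.X a ω ∈ K} = ∅ from ?_, measure_empty, zero_mul]
      · exact zero_le
      · refine Set.eq_empty_of_forall_notMem fun ω hω => hz ?_
        exact hω.1 ▸ hω.2
  calc k2 * k3 * M.surv s x0
      ≤ k2 * (M.P x0 {ω | M.X a ω ∈ K} * ENNReal.ofReal (Real.exp (l * a))) * M.surv s x0 := by
        gcongr; exact h3 a
    _ = M.P x0 {ω | M.X a ω ∈ K} * (k2 * M.surv s x0) * ENNReal.ofReal (Real.exp (l * a)) := by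
        ring
    _ ≤ _ := mul_le_mul_left h _

theorem surv_mul_le_gridExp (hK : 0 ∉ K) (hx0 : x0 ∈ K)
    (h2 : ∀ t, ∀ x ∈ K, ∀ y ∈ K, k2 * M.surv t y ≤ M.surv t x)
    (h3 : ∀ t : ℝ≥0, k3 ≤ M.P x0 {ω | M.X t ω ∈ K} * ENNReal.ofReal (Real.exp (l * t)))
    (h : ℝ≥0) (n : ℕ) (a : ℝ≥0) (x : ℕ) :
    k2 ^ 2 * k3 * M.surv (n * h) x
      ≤ M.surv (n * h + a) x0 * ENNReal.ofReal (Real.exp (l * a))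
        * ∫⁻ ω, gridExp (insert 0 K) l h n (fun u => M.X u ω) ∂M.P x := by
  have hx00 : x0 ≠ 0 := fun h0 => hK (h0 ▸ hx0)
  have hk2 : k2 ≤ 1 := by
    have := h2 0 x0 hx0 x0 hx0
    rwa [M.surv_zero_left hx00, mul_one] at this
  have hret := M.surv_le_surv_add hK hx0 h2 h3
  induction n generalizing a x with
  | zero =>
    simp only [Nat.cast_zero, zero_mul, gridExp, lintegral_const, measure_univ, mul_one]
    calc k2 ^ 2 * k3 * M.surv 0 x ≤ k2 * k3 * M.surv 0 x0 := by
          rw [M.surv_zero_left hx00, mul_one]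
          calc k2 ^ 2 * k3 * M.surv 0 x = k2 * (k2 * k3 * M.surv 0 x) := by ring
            _ ≤ 1 * (k2 * k3 * 1) := by gcongr; exact M.surv_le_one 0 x
            _ = k2 * k3 := by ring
      _ ≤ _ := hret 0 a
  | succ n ih =>
    have hgrid : ∫⁻ ω, gridExp (insert 0 K) l h (n + 1) (fun u => M.X u ω) ∂M.P x
        = open Classical in if x ∈ insert 0 K then 1 else ENNReal.ofReal (Real.exp (l * h)) *
          ∑' z, M.P x {ω | M.X h ω = z} *
            ∫⁻ ω, gridExp (insert 0 K) l h n (fun u => M.X u ω) ∂M.P z := by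
      rw [← M.lintegral_shifted_path x h (measurable_gridExp _ l h n),
        ← lintegral_const_mul' _ _ ofReal_ne_top]
      split_ifs with hx
      · refine (lintegral_congr_ae ?_).trans (lintegral_one.trans measure_univ)
        filter_upwards [M.ae_init x] with ω hω
        simp [gridExp, hω, hx]
      · refine lintegral_congr_ae ?_
        filter_upwards [M.ae_init x] with ω hω
        rw [gridExp, if_neg (by rwa [hω])]
    rw [hgrid]
    split_ifs with hx
    · rcases hx with rfl | hx
      · rw [M.surv_zero_right, mul_zero]; exact zero_le
      · rw [mul_one]
        calc k2 ^ 2 * k3 * M.surv ((n + 1 : ℕ) * h) x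
            = k2 * k3 * (k2 * M.surv ((n + 1 : ℕ) * h) x) := by ring
          _ ≤ k2 * k3 * M.surv ((n + 1 : ℕ) * h) x0 := by gcongr; exact h2 _ x0 hx0 x hx
          _ ≤ _ := hret _ a
    · have hsplit : ((n + 1 : ℕ) : ℝ≥0) * h = h + n * h := by push_cast; ring
      have hcomm : h + n * h + a = n * h + (h + a) := by ring
      rw [hsplit, M.surv_add, hcomm]
      calc k2 ^ 2 * k3 * ∑' z, M.trans h x z * M.surv (n * h) z
          = ∑' z, M.trans h x z * (k2 ^ 2 * k3 * M.surv (n * h) z) := by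
            rw [← ENNReal.tsum_mul_left]
            exact tsum_congr fun z => mul_left_comm _ _ _
        _ ≤ ∑' z, M.P x {ω | M.X h ω = z} * (M.surv (n * h + (h + a)) x0
              * ENNReal.ofReal (Real.exp (l * (h + a : ℝ≥0)))
              * ∫⁻ ω, gridExp (insert 0 K) l h n (fun u => M.X u ω) ∂M.P z) := by
            refine ENNReal.tsum_le_tsum fun z => mul_le_mul' ?_ (ih (h + a) z)
            unfold trans
            split_ifs
            · exact zero_le
            · exact le_rfl
        _ = _ := by
            rw [ofReal_exp_add, ← ENNReal.tsum_mul_left, ← ENNReal.tsum_mul_left]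
            exact tsum_congr fun z => by ring

/-- Survival from an arbitrary state is dominated by survival from `x0`. -/
theorem surv_le_mul_surv (hK : 0 ∉ K) (hx0 : x0 ∈ K) (hl : 0 ≤ l)
    (hk2 : k2 ≠ 0) (hk2t : k2 ≠ ∞) (hk3 : k3 ≠ 0) (hk3t : k3 ≠ ∞)
    (h2 : ∀ t, ∀ x ∈ K, ∀ y ∈ K, k2 * M.surv t y ≤ M.surv t x)
    (h3 : ∀ t : ℝ≥0, k3 ≤ M.P x0 {ω | M.X t ω ∈ K} * ENNReal.ofReal (Real.exp (l * t)))
    {k4 : ℝ≥0∞} (hk4 : k4 ≠ ∞)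
    (h4 : ∀ x : ℕ, x ≠ 0 → ∫⁻ ω, expE l (min (hitT M K ω) (hitT M {0} ω)) ∂M.P x ≤ k4)
    {T : ℝ≥0} (hT : 0 < T) (x : ℕ) :
    M.surv T x ≤
      (k2 ^ 2 * k3)⁻¹ * (ENNReal.ofReal (Real.exp (l * (1 : ℝ≥0))) * k4 + 1) * M.surv T x0 := by
  by_cases hx : x = 0
  · rw [hx, M.surv_zero_right]; exact zero_le
  obtain ⟨N, hN⟩ := M.exists_lintegral_gridExp_lt (K := K) hl hT hk4 (h4 x hx)
  have h := M.surv_mul_le_gridExp hK hx0 h2 h3 (T / (N + 1)) (N + 1) 0 x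
  have hNT : ((N + 1 : ℕ) : ℝ≥0) * (T / (N + 1)) = T := by
    push_cast
    exact mul_div_cancel₀ _ (by positivity)
  rw [hNT, add_zero, NNReal.coe_zero, mul_zero, Real.exp_zero, ENNReal.ofReal_one, mul_one] at h
  have h' := h.trans (mul_le_mul_right hN _)
  have hk : k2 ^ 2 * k3 ≠ 0 := mul_ne_zero (pow_ne_zero 2 hk2) hk3
  have hkt : k2 ^ 2 * k3 ≠ ∞ := ENNReal.mul_ne_top (ENNReal.pow_ne_top hk2t) hk3t
  calc M.surv T x = (k2 ^ 2 * k3)⁻¹ * (k2 ^ 2 * k3 * M.surv T x) := by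
        rw [← mul_assoc, ENNReal.inv_mul_cancel hk hkt, one_mul]
    _ ≤ (k2 ^ 2 * k3)⁻¹ *
        (M.surv T x0 * (ENNReal.ofReal (Real.exp (l * (1 : ℝ≥0))) * k4 + 1)) :=
      mul_le_mul_right h' _
    _ = _ := by ring

end SurvivalBound

theorem surv_add_le (s t : ℝ≥0) (x : ℕ) : M.surv (s + t) x ≤ M.surv s x := by
  rw [surv_add, ← tsum_trans]
  exact ENNReal.tsum_le_tsum fun z => mul_le_of_le_one_right' (M.surv_le_one t z)

theorem surv_antitone (x : ℕ) : Antitone fun t => M.surv t x := fun s t hst => by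
  rw [← add_tsub_cancel_of_le hst]
  exact M.surv_add_le s _ x

theorem tsum_mul_trans_add (m : ℕ → ℝ≥0∞) (s t : ℝ≥0) (z : ℕ) :
    ∑' y, (∑' x, m x * M.trans s x y) * M.trans t y z = ∑' x, m x * M.trans (s + t) x z := by
  simp_rw [trans_add, ← ENNReal.tsum_mul_left, ← ENNReal.tsum_mul_right]
  rw [ENNReal.tsum_comm]
  simp_rw [mul_assoc]

theorem tsum_tsum_mul_trans (m : ℕ → ℝ≥0∞) (t : ℝ≥0) :
    ∑' y, ∑' x, m x * M.trans t x y = ∑' x, m x * M.surv t x := by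
  rw [ENNReal.tsum_comm]
  simp_rw [ENNReal.tsum_mul_left, tsum_trans]

theorem tsum_mul_surv_ne_top {m : ℕ → ℝ≥0∞} (hm : ∑' x, m x = 1) (t : ℝ≥0) :
    ∑' x, m x * M.surv t x ≠ ∞ := by
  refine ne_top_of_le_ne_top one_ne_top (hm ▸ ?_)
  exact ENNReal.tsum_le_tsum fun x => mul_le_of_le_one_right' (M.surv_le_one t x)

theorem tsum_measure_singleton (ρ : Measure ℕ) [IsProbabilityMeasure ρ] : ∑' x, ρ {x} = 1 := by
  rw [← measure_univ (μ := ρ), ← lintegral_one, lintegral_countable']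
  simp

/-- A law invariant under conditioning at time `t` is a left eigenvector of the transition
function. -/
theorem eigenvector_of_condDist_eq {ρ : Measure ℕ} [IsProbabilityMeasure ρ] {t : ℝ≥0}
    (h : condDist M ρ t = ρ) :
    ∑' x, ρ {x} * M.surv t x ≠ 0 ∧
      ∀ y, ∑' x, ρ {x} * M.trans t x y = (∑' x, ρ {x} * M.surv t x) * ρ {y} := by
  have hy : ∀ y, (∑' x, ρ {x} * M.surv t x)⁻¹ * ∑' x, ρ {x} * M.trans t x y = ρ {y} :=
    fun y => by rw [← M.condDist_singleton, h]
  have h0 : ∑' x, ρ {x} * M.surv t x ≠ 0 := by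
    intro h0
    have h1 := h0
    rw [← tsum_tsum_mul_trans, ENNReal.tsum_eq_zero] at h1
    have h2 : ∀ y, ρ {y} = 0 := fun y => by rw [← hy y, h1 y, mul_zero]
    have h3 := tsum_measure_singleton ρ
    simp [h2] at h3
  refine ⟨h0, fun y => ?_⟩
  rw [← hy y, ← mul_assoc, ENNReal.mul_inv_cancel h0
    (M.tsum_mul_surv_ne_top (tsum_measure_singleton ρ) t), one_mul]

end AbsorbedProcess

/-- under Hypothesis (H) there exists exactly one quasi-stationary
distribution for `X`, i.e. exactly one probability measure `ρ` on `ℕ*` such that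
`ℙ_ρ(X_t ∈ · | t < T_0) = ρ` for all `t ≥ 0`. -/
theorem existsUnique_qsd_of_hypH (M : AbsorbedProcess Ω) (K : Set ℕ) (x0 : ℕ)
    (c1 c2 c3 c4 l0 : ℝ) (hH : HypH M K x0 c1 c2 c3 c4 l0) :
    ∃! ρ : Measure ℕ, IsProbabilityMeasure ρ ∧ ρ {0} = 0 ∧
      ∀ t : ℝ≥0, condDist M ρ t = ρ := by
  obtain ⟨hK, hx0, hc1, hc2, hc3, -, hl, H1, H2, H3, H4⟩ := hH
  simp_rw [M.measure_alive] at H1 H2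
  have hx00 : x0 ≠ 0 := fun h => hK (h ▸ hx0)
  set p := M.trans 1
  have hp : ∀ x, ∑' y, p x y ≤ 1 := fun x => (M.tsum_trans 1 x).trans_le (M.surv_le_one 1 x)
  have hc0 : ENNReal.ofReal c1 ≠ 0 := by simpa using hc1
  have hc : ∀ x, ENNReal.ofReal c1 * ∑' y, p x y ≤ p x x0 := by
    intro x
    rw [M.tsum_trans]
    by_cases hx : x = 0
    · rw [hx, M.surv_zero_right, mul_zero]; exact zero_le
    · simp only [p, AbsorbedProcess.trans, if_neg hx00]
      exact (H1 x hx).trans (measure_mono inter_subset_left)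
  have h3 : ∀ t : ℝ≥0, ENNReal.ofReal c3
      ≤ M.P x0 {ω | M.X t ω ∈ K} * ENNReal.ofReal (Real.exp (l0 * t)) := by
    intro t
    refine le_trans (le_of_eq ?_) (mul_le_mul_left (H3 t) _)
    rw [← ENNReal.ofReal_mul (by positivity), mul_assoc, ← Real.exp_add, neg_add_cancel,
      Real.exp_zero, mul_one]
  obtain ⟨C, hCt, hC⟩ : ∃ C : ℝ≥0∞, C ≠ ∞ ∧
      ∀ n x, survival p n x ≤ C * survival p n x0 := by
    set B := (ENNReal.ofReal c2 ^ 2 * ENNReal.ofReal c3)⁻¹ *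
      (ENNReal.ofReal (Real.exp (l0 * (1 : ℝ≥0))) * ENNReal.ofReal c4 + 1)
    have hBt : B ≠ ∞ := by
      refine ENNReal.mul_ne_top (ENNReal.inv_ne_top.2 (mul_ne_zero (pow_ne_zero 2 ?_) ?_))
        (ENNReal.add_ne_top.2 ⟨ENNReal.mul_ne_top ofReal_ne_top ofReal_ne_top, one_ne_top⟩)
      · simpa using hc2
      · simpa using hc3
    refine ⟨B + 1, ENNReal.add_ne_top.2 ⟨hBt, one_ne_top⟩, fun n x => ?_⟩
    cases n with
    | zero => simp [survival]
    | succ n =>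
      simp only [p, M.survival_trans_one]
      exact (M.surv_le_mul_surv hK hx0 hl.le (by simpa using hc2) ofReal_ne_top
        (by simpa using hc3) ofReal_ne_top H2 h3 ofReal_ne_top H4 (by positivity) x).trans
        (mul_le_mul_left le_self_add _)
  have hpos : ∀ n, survival p n x0 ≠ 0 := by
    intro n h0
    cases n with
    | zero => simp [survival] at h0
    | succ n =>
      simp only [p, M.survival_trans_one] at h0
      have h1 : M.P x0 {ω | M.X (n + 1) ω ∈ K} = 0 := by
        refine measure_mono_null (fun ω hω => ?_) h0
        exact fun h => hK (h ▸ hω)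
      have h2 := h3 (n + 1)
      rw [h1, zero_mul, nonpos_iff_eq_zero, ENNReal.ofReal_eq_zero] at h2
      linarith
  obtain ⟨m, θ, hm, hθ, he⟩ := exists_eigenvector hp hc0 hc hCt hC hpos
  have hms : ∀ t, ∑' x, m x * M.surv t x ≠ 0 := by
    intro t h0
    obtain ⟨n, hn⟩ := exists_nat_ge t
    have h1 := tsum_mul_survival_of_eigenvector hm he (n + 1)
    simp only [p, M.survival_trans_one] at h1
    refine pow_ne_zero (n + 1) hθ (le_antisymm ?_ bot_le)
    rw [← h1, ← h0]
    exact ENNReal.tsum_le_tsum fun x =>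
      mul_le_mul_right (M.surv_antitone x (hn.trans le_self_add)) _
  have hmt : ∀ t y, (∑' x, m x * M.surv t x)⁻¹ * ∑' x, m x * M.trans t x y = m y := by
    intro t
    refine congr_fun (eigenvector_unique hp hc0 ofReal_ne_top hc hCt hC ?_ hm hθ hθ
      (fun z => ?_) he)
    · rw [ENNReal.tsum_mul_left, M.tsum_tsum_mul_trans,
        ENNReal.inv_mul_cancel (hms t) (M.tsum_mul_surv_ne_top hm t)]
    · simp_rw [mul_assoc]
      rw [ENNReal.tsum_mul_left, M.tsum_mul_trans_add, add_comm t 1, ← M.tsum_mul_trans_add]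
      have he1 : ∀ y, ∑' x, m x * M.trans 1 x y = θ * m y := he
      simp_rw [he1, mul_assoc]
      rw [ENNReal.tsum_mul_left, mul_left_comm]
  set ρ : Measure ℕ := Measure.sum fun x => m x • Measure.dirac x
  have hρ : ∀ y, ρ {y} = m y := by
    intro y
    rw [Measure.sum_apply _ (measurableSet_singleton y), tsum_eq_single y]
    · simp
    · intro x hx
      simp [hx]
  refine ⟨ρ, ⟨⟨?_⟩, ?_, fun t => ?_⟩, ?_⟩
  · rw [Measure.sum_apply _ MeasurableSet.univ]
    simpa using hm
  · have h0 := he 0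
    simp only [p, AbsorbedProcess.trans, if_true, mul_zero, tsum_zero] at h0
    rw [hρ]
    exact (mul_eq_zero.1 h0.symm).resolve_left hθ
  · refine Measure.ext_of_singleton fun y => ?_
    rw [M.condDist_singleton]
    simp_rw [hρ]
    exact hmt t y
  · rintro ν ⟨hν, -, hνt⟩
    obtain ⟨hν0, hνe⟩ := M.eigenvector_of_condDist_eq (hνt 1)
    have := eigenvector_unique hp hc0 ofReal_ne_top hc hCt hC
      (AbsorbedProcess.tsum_measure_singleton ν) hm hν0 hθ hνe he
    refine Measure.ext_of_singleton fun y => ?_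
    rw [hρ]
    exact congr_fun this y

end
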